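/- arXiv:1203.5022 — 3 statements merged into one kernel-verified Lean document; each statement's English description precedes it below -/
import Mathlib

section
/- For every integer n ≥ 1 and every real z ∈ (0, n + 1/2 − (n + 1/2)^{2/3}), the spherical Bessel function satisfies j_n(z) < √(π/(2n+1)) · exp(2/3 − (1/3)(n + 1/2)^{1/3}). -/
open Real

/-- The Bessel function of the first kind of order `ν`. -/
noncomputable def besselJ (ν : ℝ) (x : ℝ) : ℝ :=
  ∑' k : ℕ, ((-1 : ℝ) ^ k / ((k.factorial : ℝ) * Real.Gamma ((k : ℝ) + ν + 1))) *
    (x / 2) ^ (2 * (k : ℝ) + ν)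

/-- The spherical Bessel function `j_n(x) = √(π/(2x)) J_{n+1/2}(x)`. -/
noncomputable def sbesselJ (n : ℕ) (x : ℝ) : ℝ :=
  Real.sqrt (π / (2 * x)) * besselJ ((n : ℝ) + 1 / 2) x


/-- coefficients -/
noncomputable def gco (ν : ℝ) (k : ℕ) : ℝ := (-1 : ℝ) ^ k / ((k.factorial : ℝ) * Real.Gamma ((k : ℝ) + ν + 1))

noncomputable def gser (ν y : ℝ) : ℝ := ∑' k : ℕ, gco ν k * y ^ k

lemma gamma_le (ν : ℝ) (hν : 0 ≤ ν) (k : ℕ) : Real.Gamma (ν + 1) ≤ Real.Gamma ((k : ℝ) + ν + 1) := by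
  induction k with
  | zero => simp
  | succ k ih =>
    have h0 : (0:ℝ) ≤ k := Nat.cast_nonneg k
    have h : Real.Gamma ((k : ℝ) + ν + 1 + 1) = ((k : ℝ) + ν + 1) * Real.Gamma ((k : ℝ) + ν + 1) :=
      Real.Gamma_add_one (by positivity)
    have h1 : 0 < Real.Gamma ((k : ℝ) + ν + 1) := Real.Gamma_pos_of_pos (by positivity)
    have e : ((k + 1 : ℕ) : ℝ) + ν + 1 = (k : ℝ) + ν + 1 + 1 := by push_cast; ring
    rw [e, h]
    nlinarith

lemma gco_bound (ν : ℝ) (hν : 0 ≤ ν) (k : ℕ) : |gco ν k| ≤ (Real.Gamma (ν + 1))⁻¹ * ((k.factorial : ℝ))⁻¹ := by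
  have h1 : 0 < Real.Gamma (ν + 1) := Real.Gamma_pos_of_pos (by positivity)
  have h2 := gamma_le ν hν k
  have h3 : 0 < Real.Gamma ((k : ℝ) + ν + 1) := lt_of_lt_of_le h1 h2
  have hf : (0:ℝ) < k.factorial := by exact_mod_cast k.factorial_pos
  unfold gco
  rw [abs_div, abs_pow, abs_neg, abs_one, one_pow, abs_of_pos (by positivity), ← mul_inv, one_div, mul_comm]
  gcongr

lemma gser_summable (ν : ℝ) (hν : 0 ≤ ν) (y : ℝ) : Summable (fun k : ℕ => gco ν k * y ^ k) := by
  have := (Real.summable_pow_div_factorial |y|).mul_left (Real.Gamma (ν + 1))⁻¹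
  refine Summable.of_norm_bounded this (fun k => ?_)
  rw [Real.norm_eq_abs, abs_mul, abs_pow]
  have := mul_le_mul_of_nonneg_right (gco_bound ν hν k) (by positivity : 0 ≤ |y| ^ k)
  refine this.trans (le_of_eq ?_)
  ring

lemma gco_succ (ν : ℝ) (k : ℕ) : gco ν (k + 1) * ((k:ℝ) + 1) = - gco (ν + 1) k := by
  unfold gco
  have hf : (k.factorial : ℝ) ≠ 0 := by exact_mod_cast k.factorial_ne_zero
  have e : ((k + 1 : ℕ) : ℝ) + ν + 1 = (k : ℝ) + (ν + 1) + 1 := by push_cast; ring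
  rw [e, Nat.factorial_succ, pow_succ]
  push_cast
  have hk : (k:ℝ) + 1 ≠ 0 := by positivity
  by_cases hg : Real.Gamma ((k : ℝ) + (ν + 1) + 1) = 0
  · simp [hg]
  field_simp

lemma gser_hasDerivAt (ν : ℝ) (hν : 0 ≤ ν) (y : ℝ) : HasDerivAt (gser ν) (- gser (ν + 1) y) y := by
  obtain ⟨r, hr⟩ : ∃ r, |y| < r := exists_gt _
  have hr0 : 0 < r := lt_of_le_of_lt (abs_nonneg _) hr
  have key := hasDerivAt_tsum_of_isPreconnected (𝕜 := ℝ)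
    (u := fun k : ℕ => (Real.Gamma (ν + 1))⁻¹ * ((k.factorial : ℝ))⁻¹ * (k * r ^ (k - 1)))
    (g := fun (k : ℕ) (x : ℝ) => gco ν k * x ^ k) (g' := fun (k : ℕ) (x : ℝ) => gco ν k * (k * x ^ (k - 1)))
    (t := Metric.ball 0 r) (y₀ := 0) (y := y) ?_ Metric.isOpen_ball
    (convex_ball _ _).isPreconnected ?_ ?_ (by simpa using hr0) (gser_summable ν hν 0) (by simpa using hr)
  · have e : (∑' k : ℕ, gco ν k * (k * y ^ (k - 1))) = - gser (ν + 1) y := by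
      have hs : Summable (fun k : ℕ => gco ν (k + 1) * (((k + 1 : ℕ) : ℝ) * y ^ (k + 1 - 1))) := by
        refine ((gser_summable (ν + 1) (by linarith) y).neg).congr (fun k => ?_)
        simp only [Nat.add_sub_cancel]
        push_cast
        rw [← mul_assoc, gco_succ]; ring
      rw [((summable_nat_add_iff (f := fun k : ℕ => gco ν k * (k * y ^ (k - 1))) 1).1 hs).tsum_eq_zero_add]
      simp only [Nat.cast_zero, zero_mul, mul_zero, zero_add, Nat.add_sub_cancel]
      unfold gser
      rw [← tsum_neg]
      refine tsum_congr (fun k => ?_)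
      push_cast
      rw [← mul_assoc, gco_succ]; ring
    rw [← e]
    exact key
  · rw [← summable_nat_add_iff 1]
    refine ((Real.summable_pow_div_factorial r).mul_left (Real.Gamma (ν + 1))⁻¹).congr (fun k => ?_)
    have hf : (k.factorial : ℝ) ≠ 0 := by exact_mod_cast k.factorial_ne_zero
    have hk : (k:ℝ) + 1 ≠ 0 := by positivity
    rw [Nat.factorial_succ]
    push_cast
    try simp only [Nat.add_sub_cancel]
    field_simp
  · intro k x _
    exact (hasDerivAt_pow k x).const_mul _
  · intro k x hx
    have hx' : |x| ≤ r := by simpa using (le_of_lt (by simpa using hx))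
    rw [Real.norm_eq_abs, abs_mul, abs_mul, abs_pow, Nat.abs_cast]
    have := gco_bound ν hν k
    gcongr

lemma gser_rec (ν : ℝ) (hν : 0 ≤ ν) (y : ℝ) :
    y * gser (ν + 2) y = (ν + 1) * gser (ν + 1) y - gser ν y := by
  have s0 := gser_summable ν hν y
  have s1 := (gser_summable (ν + 1) (by linarith) y).mul_left (ν + 1)
  have s2 := (gser_summable (ν + 2) (by linarith) y).mul_left y
  have : gser ν y = (ν + 1) * gser (ν + 1) y - y * gser (ν + 2) y := by
    unfold gser
    rw [← tsum_mul_left, ← tsum_mul_left, s0.tsum_eq_zero_add, s1.tsum_eq_zero_add]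
    rw [add_sub_assoc, ← Summable.tsum_sub ((summable_nat_add_iff 1).2 s1) s2]
    congr 1
    · have := Real.Gamma_add_one (s := ν + 1) (by positivity)
      simp only [gco]
      simp only [Nat.cast_zero, zero_add, this]
      have h1 : Real.Gamma (ν + 1) ≠ 0 := (Real.Gamma_pos_of_pos (by positivity)).ne'
      have h2 : ν + 1 ≠ 0 := by positivity
      simp
      field_simp
    · refine tsum_congr (fun k => ?_)
      have hk0 : (0:ℝ) ≤ k := Nat.cast_nonneg k
      have e := Real.Gamma_add_one (s := (k:ℝ) + ν + 2) (by positivity)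
      have h1 : Real.Gamma ((k:ℝ) + ν + 2) ≠ 0 := (Real.Gamma_pos_of_pos (by positivity)).ne'
      have h2 : (k:ℝ) + ν + 2 ≠ 0 := by positivity
      have hk : (k:ℝ) + 1 ≠ 0 := by positivity
      have hf : (k.factorial : ℝ) ≠ 0 := by exact_mod_cast k.factorial_ne_zero
      unfold gco
      rw [show ((k + 1 : ℕ) : ℝ) + ν + 1 = (k : ℝ) + ν + 2 by push_cast; ring,
        show ((k + 1 : ℕ) : ℝ) + (ν + 1) + 1 = (k : ℝ) + ν + 2 + 1 by push_cast; ring,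
        show (k : ℝ) + (ν + 2) + 1 = (k : ℝ) + ν + 2 + 1 by push_cast; ring, e, Nat.factorial_succ]
      push_cast
      field_simp
      ring
  linarith

lemma gser_zero (ν : ℝ) : gser ν 0 = (Real.Gamma (ν + 1))⁻¹ := by
  unfold gser
  rw [tsum_eq_single 0]
  · simp [gco]
  · intro k hk; simp [hk]

lemma gser_cont (ν : ℝ) (hν : 0 ≤ ν) : Continuous (gser ν) :=
  continuous_iff_continuousAt.2 (fun y => (gser_hasDerivAt ν hν y).continuousAt)

/-- the combination `ν A - 2 y B` -/
noncomputable def gP (ν y : ℝ) : ℝ := ν * gser ν y - 2 * y * gser (ν + 1) y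

lemma gP_hasDerivAt (ν : ℝ) (hν : 0 ≤ ν) (y : ℝ) :
    HasDerivAt (gP ν) (ν * gser (ν + 1) y - 2 * gser ν y) y := by
  have h1 := (gser_hasDerivAt ν hν y).const_mul ν
  have h2 := ((hasDerivAt_id y).const_mul 2).mul (gser_hasDerivAt (ν + 1) (by linarith) y)
  have h3 := h1.sub h2
  refine h3.congr_deriv ?_
  have := gser_rec ν hν y
  rw [show ν + 1 + 1 = ν + 2 by ring]
  try simp only [id]
  linarith

lemma rpow_split (ν y : ℝ) (hy : 0 < y) : y ^ ν = y ^ (ν - 1) * y := by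
  rw [Real.rpow_sub_one hy.ne']; field_simp

lemma energy_nonneg (ν : ℝ) (hν : 1 ≤ ν) (y : ℝ) (hy0 : 0 ≤ y) (hy : 4 * y ≤ ν ^ 2) :
    0 ≤ y ^ ν * (gser ν y * gP ν y) := by
  have hd : ∀ x, HasDerivAt (fun t => t ^ ν * (gser ν t * gP ν t)) _ x := fun x =>
    (Real.hasDerivAt_rpow_const (x := x) (Or.inr hν)).mul
      ((gser_hasDerivAt ν (by linarith) x).mul (gP_hasDerivAt ν (by linarith) x))
  have mono : MonotoneOn (fun t => t ^ ν * (gser ν t * gP ν t)) (Set.Icc 0 y) := by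
    apply monotoneOn_of_deriv_nonneg (convex_Icc _ _)
    · exact fun x _ => (hd x).continuousAt.continuousWithinAt
    · exact fun x _ => (hd x).differentiableAt.differentiableWithinAt
    · intro x hx
      rw [interior_Icc] at hx
      rw [(hd x).deriv]
      try simp only [Pi.mul_apply]
      rw [rpow_split ν x hx.1]
      have hp : 0 ≤ x ^ (ν - 1) := (Real.rpow_pos_of_pos hx.1 _).le
      have hB : gP ν x = ν * gser ν x - 2 * x * gser (ν + 1) x := rfl
      have h4 : 0 ≤ ν ^ 2 - 4 * x := by linarith [hx.2]
      have : 0 ≤ x ^ (ν - 1) * ((gP ν x) ^ 2 / 2 + (ν ^ 2 - 4 * x) * (gser ν x) ^ 2 / 2) := by positivity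
      refine this.trans (le_of_eq ?_)
      rw [hB]; ring
  have := mono (Set.left_mem_Icc.2 hy0) (Set.right_mem_Icc.2 hy0) hy0
  simpa [Real.zero_rpow (by linarith : ν ≠ 0)] using this

lemma gser_sq_mono (ν : ℝ) (hν : 1 ≤ ν) (Y : ℝ) (hY : 4 * Y ≤ ν ^ 2) :
    MonotoneOn (fun t => t ^ ν * (gser ν t * gser ν t)) (Set.Icc 0 Y) := by
  have hd : ∀ x, HasDerivAt (fun t => t ^ ν * (gser ν t * gser ν t)) _ x := fun x =>
    (Real.hasDerivAt_rpow_const (x := x) (Or.inr hν)).mul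
      ((gser_hasDerivAt ν (by linarith) x).mul (gser_hasDerivAt ν (by linarith) x))
  apply monotoneOn_of_deriv_nonneg (convex_Icc _ _)
  · exact fun x _ => (hd x).continuousAt.continuousWithinAt
  · exact fun x _ => (hd x).differentiableAt.differentiableWithinAt
  · intro x hx
    rw [interior_Icc] at hx
    rw [(hd x).deriv]
    try simp only [Pi.mul_apply]
    have h := energy_nonneg ν hν x hx.1.le (by linarith [hx.2])
    have hp := (Real.rpow_pos_of_pos hx.1 (ν - 1))
    have hB : gP ν x = ν * gser ν x - 2 * x * gser (ν + 1) x := rfl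
    rw [rpow_split ν x hx.1] at h ⊢
    have : 0 ≤ x⁻¹ * (x ^ (ν - 1) * x * (gser ν x * gP ν x)) := mul_nonneg (inv_nonneg.2 hx.1.le) h
    refine this.trans (le_of_eq ?_)
    rw [hB]
    have := hx.1.ne'
    field_simp
    ring

lemma gser_ne (ν : ℝ) (hν : 1 ≤ ν) (y : ℝ) (hy0 : 0 ≤ y) (hy : 4 * y ≤ ν ^ 2) : gser ν y ≠ 0 := by
  have hA0 : 0 < gser ν 0 := by
    rw [gser_zero]; exact inv_pos.2 (Real.Gamma_pos_of_pos (by linarith))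
  intro h
  rcases hy0.eq_or_lt with rfl | hpos
  · exact hA0.ne' h
  have hz : ∀ x ∈ Set.Ioo 0 y, gser ν x = 0 := by
    intro x hx
    have := gser_sq_mono ν hν y hy ⟨hx.1.le, hx.2.le⟩ (Set.right_mem_Icc.2 hy0) hx.2.le
    simp only [h, mul_zero] at this
    have hp := (Real.rpow_pos_of_pos hx.1 ν)
    by_contra hne
    have : 0 < x ^ ν * (gser ν x * gser ν x) := mul_pos hp (mul_self_pos.2 hne)
    linarith
  have hcl : Set.EqOn (gser ν) (fun _ => 0) (closure (Set.Ioo 0 y)) :=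
    Set.EqOn.closure (fun x hx => hz x hx) (gser_cont ν (by linarith)) continuous_const
  rw [closure_Ioo hpos.ne] at hcl
  exact hA0.ne' (hcl (Set.left_mem_Icc.2 hy0))

lemma gser_pos (ν : ℝ) (hν : 1 ≤ ν) (y : ℝ) (hy0 : 0 ≤ y) (hy : 4 * y ≤ ν ^ 2) : 0 < gser ν y := by
  have hA0 : 0 < gser ν 0 := by
    rw [gser_zero]; exact inv_pos.2 (Real.Gamma_pos_of_pos (by linarith))
  by_contra hn
  push Not at hn
  obtain ⟨c, hc, hc0⟩ := intermediate_value_Icc' hy0 (gser_cont ν (by linarith)).continuousOn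
    (show (0:ℝ) ∈ Set.Icc (gser ν y) (gser ν 0) from ⟨hn, hA0.le⟩)
  exact gser_ne ν hν c hc.1 (by linarith [hc.2]) hc0

noncomputable def sqr (ν y : ℝ) : ℝ := √(ν ^ 2 - 4 * y)

noncomputable def phi (ν y : ℝ) : ℝ := sqr ν y - ν * Real.log (ν + sqr ν y) - 1 / 2 * Real.log (sqr ν y)

lemma sq_hasDerivAt (ν y : ℝ) (hy : 4 * y < ν ^ 2) : HasDerivAt (sqr ν) (-2 / sqr ν y) y := by
  have h : HasDerivAt (fun y : ℝ => ν ^ 2 - 4 * y) (-4) y := by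
    simpa using ((hasDerivAt_id y).const_mul 4).const_sub (ν ^ 2)
  refine (h.sqrt (by linarith)).congr_deriv ?_
  unfold sqr
  rw [show (-4:ℝ) = 2 * (-2) by norm_num, mul_div_mul_left _ _ (by norm_num)]

lemma sq_pos' (ν y : ℝ) (hy : 4 * y < ν ^ 2) : 0 < sqr ν y := Real.sqrt_pos.2 (by linarith)

lemma sq_sq (ν y : ℝ) (hy : 4 * y < ν ^ 2) : sqr ν y ^ 2 = ν ^ 2 - 4 * y := Real.sq_sqrt (by linarith)

lemma phi_hasDerivAt (ν y : ℝ) (hν : 0 < ν) (hy : 4 * y < ν ^ 2) :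
    HasDerivAt (phi ν) (-2 / (ν + sqr ν y) + 1 / sqr ν y ^ 2) y := by
  have hs := sq_hasDerivAt ν y hy
  have hp := sq_pos' ν y hy
  have h := (hs.sub (((hs.const_add ν).log (by positivity)).const_mul ν)).sub ((hs.log hp.ne').const_mul (1/2))
  refine h.congr_deriv ?_
  field_simp
  ring

lemma U_hasDerivAt (ν y : ℝ) (hy : 4 * y < ν ^ 2) :
    HasDerivAt (fun y => sqr ν y + 2 * y / sqr ν y ^ 2)
      (-2 / sqr ν y + 2 / sqr ν y ^ 2 + 8 * y / sqr ν y ^ 4) y := by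
  have hs := sq_hasDerivAt ν y hy
  have hp := sq_pos' ν y hy
  have h := hs.add (((hasDerivAt_id y).const_mul 2).div (hs.pow 2) (by simp only [Pi.pow_apply]; positivity))
  refine h.congr_deriv ?_
  try simp only [Pi.pow_apply, id]
  field_simp
  ring

lemma D_nonpos (ν : ℝ) (hν : 1 ≤ ν) (Y : ℝ) (hY0 : 0 < Y) (hY : 4 * Y < ν ^ 2) :
    gP ν Y - (sqr ν Y + 2 * Y / sqr ν Y ^ 2) * gser ν Y ≤ 0 := by
  have hd : ∀ x, 4 * x < ν ^ 2 → HasDerivAt (fun t => t ^ ν * (Real.exp (phi ν t) *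
      (gP ν t - (sqr ν t + 2 * t / sqr ν t ^ 2) * gser ν t))) _ x := fun x hx =>
    (Real.hasDerivAt_rpow_const (x := x) (Or.inr hν)).mul
      ((phi_hasDerivAt ν x (by linarith) hx).exp.mul
        ((gP_hasDerivAt ν (by linarith) x).sub
          ((U_hasDerivAt ν x hx).mul (gser_hasDerivAt ν (by linarith) x))))
  have anti : AntitoneOn (fun t => t ^ ν * (Real.exp (phi ν t) *
      (gP ν t - (sqr ν t + 2 * t / sqr ν t ^ 2) * gser ν t))) (Set.Icc 0 Y) := by
    apply antitoneOn_of_deriv_nonpos (convex_Icc _ _)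
    · exact fun x hx => (hd x (by linarith [hx.2])).continuousAt.continuousWithinAt
    · rw [interior_Icc]
      exact fun x hx => (hd x (by linarith [hx.2])).differentiableAt.differentiableWithinAt
    · intro x hx
      rw [interior_Icc] at hx
      have hx4 : 4 * x < ν ^ 2 := by linarith [hx.2]
      rw [(hd x hx4).deriv]
      try simp only [Pi.mul_apply, Pi.sub_apply]
      rw [rpow_split ν x hx.1]
      have hp : 0 < x ^ (ν - 1) := (Real.rpow_pos_of_pos hx.1 _)
      have hs := sq_pos' ν x hx4
      have hss := sq_sq ν x hx4
      have hA := gser_pos ν hν x hx.1.le hx4.le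
      have hB : gP ν x = ν * gser ν x - 2 * x * gser (ν + 1) x := rfl
      have hx0 := hx.1
      have hE := Real.exp_pos (phi ν x)
      rw [hB]
      generalize gser ν x = A at *
      generalize gser (ν + 1) x = B at *
      generalize sqr ν x = s at *
      generalize Real.exp (phi ν x) = E at *
      generalize x ^ (ν - 1) = p at *
      have : 0 ≤ p * E * A / 2 * (20 * x ^ 2 / s ^ 4 + 4 * x / s ^ 2) := by positivity
      have e : x = (ν ^ 2 - s ^ 2) / 4 := by linarith
      have hνs : ν + s ≠ 0 := by positivity
      refine le_of_eq_of_le ?_ (neg_nonpos.2 this)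
      rw [e]
      field_simp
      ring
  have := anti (Set.left_mem_Icc.2 hY0.le) (Set.right_mem_Icc.2 hY0.le) hY0.le
  simp only [Real.zero_rpow (by linarith : ν ≠ 0), zero_mul] at this
  by_contra hn
  push Not at hn
  have := mul_pos (Real.rpow_pos_of_pos hY0 ν) (mul_pos (Real.exp_pos (phi ν Y)) hn)
  linarith

lemma gser_bound (ν : ℝ) (hν : 1 ≤ ν) (Y : ℝ) (hY0 : 0 < Y) (hY : 4 * Y < ν ^ 2) :
    gser ν Y ≤ (Real.Gamma (ν + 1))⁻¹ * Real.exp (phi ν Y - phi ν 0) := by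
  have hd : ∀ x, 4 * x < ν ^ 2 → HasDerivAt (fun t => gser ν t * Real.exp (- phi ν t)) _ x := fun x hx =>
    (gser_hasDerivAt ν (by linarith) x).mul (phi_hasDerivAt ν x (by linarith) hx).neg.exp
  have anti : AntitoneOn (fun t => gser ν t * Real.exp (- phi ν t)) (Set.Icc 0 Y) := by
    apply antitoneOn_of_deriv_nonpos (convex_Icc _ _)
    · exact fun x hx => (hd x (by linarith [hx.2])).continuousAt.continuousWithinAt
    · rw [interior_Icc]
      exact fun x hx => (hd x (by linarith [hx.2])).differentiableAt.differentiableWithinAt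
    · intro x hx
      rw [interior_Icc] at hx
      have hx4 : 4 * x < ν ^ 2 := by linarith [hx.2]
      rw [(hd x hx4).deriv]
      have hD := D_nonpos ν hν x hx.1 hx4
      have hs := sq_pos' ν x hx4
      have hss := sq_sq ν x hx4
      have hB : gP ν x = ν * gser ν x - 2 * x * gser (ν + 1) x := rfl
      have hx0 := hx.1
      try simp only [Pi.neg_apply]
      have hE := Real.exp_pos (- phi ν x)
      rw [hB] at hD
      generalize gser ν x = A at *
      generalize gser (ν + 1) x = B at *
      generalize sqr ν x = s at *
      generalize Real.exp (- phi ν x) = E at *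
      have hνs : ν + s ≠ 0 := by positivity
      have : (2 * x)⁻¹ * E * (ν * A - 2 * x * B - (s + 2 * x / s ^ 2) * A) ≤ 0 :=
        mul_nonpos_of_nonneg_of_nonpos (by positivity) hD
      refine le_of_eq_of_le ?_ this
      have e : 4 * x = (ν - s) * (ν + s) := by linarith
      have e2 : -2 / (ν + s) = (s - ν) / (2 * x) := by
        rw [div_eq_div_iff hνs (by positivity)]; linarith
      rw [e2]
      field_simp
      ring
  have := anti (Set.left_mem_Icc.2 hY0.le) (Set.right_mem_Icc.2 hY0.le) hY0.le
  simp only [gser_zero] at this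
  have h2 := mul_le_mul_of_nonneg_right this (Real.exp_pos (phi ν Y)).le
  rw [mul_assoc, ← Real.exp_add, mul_assoc, ← Real.exp_add] at h2
  simp only [neg_add_cancel, Real.exp_zero, mul_one] at h2
  refine h2.trans (le_of_eq ?_)
  congr 2; ring

lemma stirling_low (n : ℕ) : Real.log 2 + ((n:ℝ) + 1/2) * Real.log ((n:ℝ) + 1/2) - ((n:ℝ) + 1/2)
    ≤ Real.log (Real.Gamma ((n:ℝ) + 1/2 + 1)) := by
  induction n with
  | zero =>
    have h1 : Real.Gamma (((0:ℕ):ℝ) + 1/2 + 1) = 1/2 * √π := by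
      rw [Nat.cast_zero, zero_add, Real.Gamma_add_one (by norm_num), Real.Gamma_one_half_eq]
    rw [h1, Real.log_mul (by norm_num) (by positivity), Real.log_sqrt pi_pos.le]
    have h2 : Real.log (1/2) = - Real.log 2 := by rw [one_div, Real.log_inv]
    simp only [Nat.cast_zero, zero_add]
    rw [h2]
    have h3 : 3 * Real.log 2 - 1 ≤ Real.log π := by
      have : Real.log 3 ≤ Real.log π := Real.log_le_log (by norm_num) pi_gt_three.le
      have h4 : Real.log 8 = 3 * Real.log 2 := by
        rw [show (8:ℝ) = 2 ^ 3 by norm_num, Real.log_pow]; norm_num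
      have h5 : Real.log 8 = Real.log 3 + Real.log (8/3) := by
        rw [← Real.log_mul (by norm_num) (by norm_num)]; norm_num
      have h6 : Real.log (8/3) ≤ 1 := by
        rw [Real.log_le_iff_le_exp (by norm_num)]
        linarith [Real.exp_one_gt_d9]
      linarith
    linarith
  | succ n ih =>
    have e : ((n + 1 : ℕ) : ℝ) + 1/2 = ((n:ℝ) + 1/2) + 1 := by push_cast; ring
    rw [e]
    have hν : 0 < (n:ℝ) + 1/2 := by positivity
    generalize (n:ℝ) + 1/2 = ν at *
    rw [Real.Gamma_add_one (by positivity), Real.log_mul (by positivity) (Real.Gamma_pos_of_pos (by positivity)).ne']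
    have h : Real.log (ν + 1) - Real.log ν ≤ 1 / ν := by
      rw [← Real.log_div (by positivity) (by positivity)]
      have := Real.log_le_sub_one_of_pos (show 0 < (ν + 1) / ν by positivity)
      refine this.trans (le_of_eq ?_)
      field_simp
      ring
    have h' := mul_le_mul_of_nonneg_left h hν.le
    rw [mul_one_div_cancel hν.ne'] at h'
    nlinarith

lemma atanh_low (q : ℝ) (h0 : 0 ≤ q) (h1 : q < 1) :
    2 * (q + q ^ 3 / 3) ≤ Real.log (1 + q) - Real.log (1 - q) := by
  have h := Real.hasSum_log_sub_log_of_abs_lt_one (x := q) (by rw [abs_of_nonneg h0]; exact h1)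
  have := h.summable.sum_le_tsum (Finset.range 2) (fun k _ => by positivity)
  rw [h.tsum_eq] at this
  refine le_trans (le_of_eq ?_) this
  simp [Finset.sum_range_succ]
  ring

lemma final_ineq (n : ℕ) (hn : 1 ≤ n) (ν q : ℝ) (hν : ν = (n:ℝ) + 1/2) (hq0 : 0 < q) (hq1 : q < 1)
    (hq : ν ^ (-(1:ℝ)/3) ≤ q ^ 2) :
    (n:ℝ) * (1/2 * (Real.log (1 - q) + Real.log (1 + q))) + ν * q - ν * Real.log (1 + q)
      - 1/2 * Real.log q - Real.log 2 < 2/3 - 1/3 * ν ^ ((1:ℝ)/3) := by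
  have hn' : (1:ℝ) ≤ n := by exact_mod_cast hn
  have hνpos : 0 < ν := by linarith
  have ha := atanh_low q hq0.le hq1
  have hl : 0 ≤ Real.log (1 + q) := Real.log_nonneg (by linarith)
  -- t = ν^(1/6)
  obtain ⟨t, ht0, ht⟩ : ∃ t : ℝ, 0 < t ∧ t ^ 6 = ν :=
    ⟨ν ^ ((1:ℝ)/6), by positivity, by rw [← Real.rpow_natCast, ← Real.rpow_mul hνpos.le]; norm_num⟩
  have e1 : ν ^ ((1:ℝ)/3) = t ^ 2 := by
    rw [← ht, ← Real.rpow_natCast, ← Real.rpow_mul ht0.le, ← Real.rpow_natCast]; norm_num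
  have e2 : ν ^ (-(1:ℝ)/3) = (t ^ 2)⁻¹ := by
    rw [neg_div, Real.rpow_neg hνpos.le, e1]
  have ht1 : 1 < t := by
    by_contra hc
    push Not at hc
    have : t ^ 6 ≤ 1 := pow_le_one₀ ht0.le hc
    linarith
  rw [e1]
  rw [e2, ← inv_pow] at hq
  have hqt : t⁻¹ ≤ q := le_of_sq_le_sq hq hq0.le
  have hq3 : (t⁻¹) ^ 3 ≤ q ^ 3 := by gcongr
  have hlq : - Real.log q ≤ Real.log t := by
    have := Real.log_le_log (by positivity) hqt
    rw [Real.log_inv] at this; linarith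
  have hlt : Real.log t ≤ t - 1 := Real.log_le_sub_one_of_pos ht0
  have hl2 : 1/2 < Real.log 2 := by linarith [Real.log_two_gt_d9]
  have hn3 : (n:ℝ) * (t⁻¹)^3 ≤ n * q ^ 3 := by gcongr
  have hnt : (n:ℝ) * (t⁻¹)^3 = t ^ 3 - 1/2 * (t⁻¹)^3 := by
    have : (n:ℝ) = t ^ 6 - 1/2 := by linarith
    rw [this]; field_simp
  have hti : (t⁻¹)^3 ≤ 1 := pow_le_one₀ (by positivity) (inv_le_one_of_one_le₀ ht1.le)
  have hmul := mul_le_mul_of_nonneg_left ha (by linarith : (0:ℝ) ≤ n / 2)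
  rw [hν]
  -- sufficient: polynomial inequality in t
  have hpoly : -(t ^ 3)/3 + 1/6 + 1/2 + (t - 1)/2 - 1/2 < 2/3 - 1/3 * t^2 := by
    nlinarith [mul_pos (sub_pos.2 ht1) ht0, mul_nonneg (sub_pos.2 ht1).le (sq_nonneg t), mul_nonneg (sub_pos.2 ht1).le (sq_nonneg (t-1))]
  nlinarith

lemma bessel_eq (ν z : ℝ) (hz : 0 < z) : besselJ ν z = (z/2) ^ ν * gser ν (z ^ 2 / 4) := by
  unfold besselJ gser
  rw [← tsum_mul_left]
  refine tsum_congr (fun k => ?_)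
  rw [Real.rpow_add (by positivity), show (2 * (k:ℝ)) = ((2 * k : ℕ) : ℝ) by push_cast; ring, Real.rpow_natCast, pow_mul]
  unfold gco
  rw [show (z/2)^2 = z^2/4 by ring]
  ring

theorem spherical_bessel_bound (n : ℕ) (hn : 1 ≤ n)
    (z : ℝ) (hz : z ∈ Set.Ioo (0 : ℝ) (((n : ℝ) + 1 / 2) - ((n : ℝ) + 1 / 2) ^ ((2 : ℝ) / 3))) :
    sbesselJ n z <
      Real.sqrt (π / (2 * (n : ℝ) + 1)) *
        Real.exp (2 / 3 - 1 / 3 * ((n : ℝ) + 1 / 2) ^ ((1 : ℝ) / 3)) := by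
  obtain ⟨hz0, hz1⟩ := hz
  have hn' : (1:ℝ) ≤ n := by exact_mod_cast hn
  obtain ⟨ν, hν⟩ : ∃ ν : ℝ, ν = (n:ℝ) + 1/2 := ⟨_, rfl⟩
  have hst := stirling_low n
  have e2n : 2 * (n:ℝ) + 1 = 2 * ν := by rw [hν]; ring
  unfold sbesselJ
  rw [e2n]
  rw [← hν] at hz1 hst ⊢
  have hν1 : 1 ≤ ν := by linarith
  have hν0 : 0 < ν := by linarith
  obtain ⟨x, hx⟩ : ∃ x, x = z / ν := ⟨_, rfl⟩
  have hzx : z = ν * x := by rw [hx]; field_simp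
  have hx0 : 0 < x := by rw [hx]; positivity
  have hpow : ν ^ ((2:ℝ)/3) = ν * ν ^ (-(1:ℝ)/3) := by
    nth_rewrite 2 [← Real.rpow_one ν]
    rw [← Real.rpow_add hν0]; norm_num
  have hxd : x < 1 - ν ^ (-(1:ℝ)/3) := by
    rw [hpow, hzx] at hz1
    have : ν * x < ν * (1 - ν ^ (-(1:ℝ)/3)) := by linarith
    exact lt_of_mul_lt_mul_left this hν0.le
  have hx1 : x < 1 := hxd.trans (by linarith [Real.rpow_pos_of_pos hν0 (-(1:ℝ)/3)])
  obtain ⟨q, hq⟩ : ∃ q, q = √(1 - x ^ 2) := ⟨_, rfl⟩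
  have hx2 : 0 < 1 - x ^ 2 := by nlinarith
  have hqq : q ^ 2 = 1 - x ^ 2 := by rw [hq]; exact Real.sq_sqrt hx2.le
  have hq0 : 0 < q := by rw [hq]; exact Real.sqrt_pos.2 hx2
  have hq1 : q < 1 := by nlinarith
  have hqb : ν ^ (-(1:ℝ)/3) ≤ q ^ 2 := by rw [hqq]; nlinarith
  have hfin := final_ineq n hn ν q hν hq0 hq1 hqb
  have hzν : 4 * (z ^ 2 / 4) < ν ^ 2 := by
    rw [hzx]
    have : 0 < ν ^ 2 * (1 - x ^ 2) := by positivity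
    linarith
  have hs : sqr ν (z ^ 2 / 4) = ν * q := by
    unfold sqr
    rw [show ν ^ 2 - 4 * (z ^ 2 / 4) = (ν * q) ^ 2 by rw [mul_pow, hqq, hzx]; ring]
    exact Real.sqrt_sq (by positivity)
  have hs0 : sqr ν 0 = ν := by
    unfold sqr
    rw [mul_zero, sub_zero]; exact Real.sqrt_sq hν0.le
  have hlx : Real.log x = 1/2 * (Real.log (1 - q) + Real.log (1 + q)) := by
    rw [← Real.log_mul (by linarith) (by linarith), show (1 - q) * (1 + q) = x ^ 2 by linarith, Real.log_pow]
    push_cast; ring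
  have hA := gser_pos ν hν1 (z ^ 2 / 4) (by positivity) hzν.le
  have hb := gser_bound ν hν1 (z ^ 2 / 4) (by positivity) hzν
  have hG : 0 < Real.Gamma (ν + 1) := Real.Gamma_pos_of_pos (by linarith)
  rw [bessel_eq ν z hz0]
  have hlb : Real.log (gser ν (z ^ 2 / 4)) ≤ - Real.log (Real.Gamma (ν + 1)) + (phi ν (z ^ 2 / 4) - phi ν 0) := by
    have := Real.log_le_log hA hb
    rwa [Real.log_mul (inv_pos.2 hG).ne' (Real.exp_pos _).ne', Real.log_inv, Real.log_exp] at this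
  have hphi : phi ν (z ^ 2 / 4) - phi ν 0 = ν * q - ν - ν * Real.log (1 + q) + ν * Real.log 2 - 1/2 * Real.log q := by
    unfold phi
    rw [hs, hs0, show ν + ν * q = ν * (1 + q) by ring, show ν + ν = ν * 2 by ring,
      Real.log_mul hν0.ne' (show 1 + q ≠ 0 by positivity), Real.log_mul hν0.ne' two_ne_zero, Real.log_mul hν0.ne' hq0.ne']
    ring
  have hz2 : 0 < (z/2) ^ ν := Real.rpow_pos_of_pos (by positivity) _
  rw [← Real.log_lt_log_iff (by positivity) (by positivity)]
  rw [Real.log_mul (by positivity) (by positivity), Real.log_mul hz2.ne' hA.ne',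
    Real.log_mul (by positivity) (Real.exp_pos _).ne', Real.log_exp, Real.log_rpow (by positivity),
    Real.log_sqrt (by positivity), Real.log_sqrt (by positivity),
    Real.log_div pi_pos.ne' (by positivity), Real.log_div pi_pos.ne' (by positivity),
    Real.log_mul two_ne_zero hz0.ne', Real.log_mul two_ne_zero hν0.ne', Real.log_div hz0.ne' two_ne_zero]
  have hlz : Real.log z = Real.log ν + Real.log x := by rw [hzx, Real.log_mul hν0.ne' hx0.ne']
  rw [hphi] at hlb
  rw [← hlx] at hfin
  rw [hlz]
  have hnx : (n:ℝ) = ν - 1/2 := by linarith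
  rw [hnx] at hfin
  linarith
end

section
/- Let n ≥ 0 be an integer, set κ = n(n+1), and define Λ_n(x) = j_n(x)² + (x²/(x² − κ)) · (j_n′(x))² for x > √κ. Then Λ_n is strictly decreasing on (√κ, ∞): for all √κ < x < y one has Λ_n(x) > Λ_n(y). Consequently, since Λ_n(γ′_{n,k}) = j_n(γ′_{n,k})² and all the critical points γ′_{n,k} exceed √κ, the absolute extremal values of j_n progressively decrease: |j_n(γ′_{n,1})| > |j_n(γ′_{n,2})| > |j_n(γ′_{n,3})| > …. -/
open Real

/-- The function Λₙ(x) = jₙ(x)² + (x²/(x² − κ))·(jₙ′(x))² with κ = n(n+1). -/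
noncomputable def LambdaFun (n : ℕ) (x : ℝ) : ℝ :=
  sbesselJ n x ^ 2 + x ^ 2 / (x ^ 2 - (n : ℝ) * ((n : ℝ) + 1)) * (deriv (sbesselJ n) x) ^ 2

/-- coefficients -/
noncomputable def sbC (n k : ℕ) : ℝ :=
  (-1 : ℝ) ^ k / (4 ^ k * (k.factorial : ℝ) * Real.Gamma ((k : ℝ) + n + 3 / 2))

noncomputable def sbH (n : ℕ) (t : ℝ) : ℝ := ∑' k : ℕ, sbC n k * t ^ k

lemma sbGamma_pos (n k : ℕ) : 0 < Real.Gamma ((k : ℝ) + n + 3 / 2) :=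
  Real.Gamma_pos_of_pos (by positivity)

lemma sbC_ne (n k : ℕ) : sbC n k ≠ 0 := by
  have := (sbGamma_pos n k).ne'
  unfold sbC
  positivity

lemma sbC_succ (n k : ℕ) :
    sbC n (k + 1) = -(1 / (4 * ((k : ℝ) + 1) * ((k : ℝ) + n + 3 / 2))) * sbC n k := by
  have h0 := (sbGamma_pos n k).ne'
  have h1 : ((k : ℝ) + n + 3 / 2) ≠ 0 := by positivity
  have h2 : Real.Gamma (((k + 1 : ℕ) : ℝ) + n + 3 / 2)
      = ((k : ℝ) + n + 3 / 2) * Real.Gamma ((k : ℝ) + n + 3 / 2) := by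
    rw [← Real.Gamma_add_one h1]; congr 1; push_cast; ring
  unfold sbC
  rw [h2, Nat.factorial_succ]
  have h3 : (k.factorial : ℝ) ≠ 0 := by positivity
  have h4 : (k : ℝ) + 1 ≠ 0 := by positivity
  push_cast
  field_simp
  ring

lemma sbC_n (n k : ℕ) : sbC n k = ((k : ℝ) + n + 3 / 2) * sbC (n + 1) k := by
  have h0 := (sbGamma_pos n k).ne'
  have h1 : ((k : ℝ) + n + 3 / 2) ≠ 0 := by positivity
  have h2 : Real.Gamma ((k : ℝ) + ((n + 1 : ℕ) : ℝ) + 3 / 2)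
      = ((k : ℝ) + n + 3 / 2) * Real.Gamma ((k : ℝ) + n + 3 / 2) := by
    rw [← Real.Gamma_add_one h1]; congr 1; push_cast; ring
  unfold sbC
  rw [h2]
  have h3 : (k.factorial : ℝ) ≠ 0 := by positivity
  field_simp

lemma sbC_diff (n k : ℕ) : ((k : ℝ) + 1) * sbC n (k + 1) = -(1 / 4) * sbC (n + 1) k := by
  have h1 : ((k : ℝ) + n + 3 / 2) ≠ 0 := by positivity
  have h4 : (k : ℝ) + 1 ≠ 0 := by positivity
  rw [sbC_succ, sbC_n]
  field_simp

lemma sb_ratio (n : ℕ) (R : ℝ) : Filter.Tendsto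
    (fun k : ℕ => R * (1 / (4 * ((k : ℝ) + 1) * ((k : ℝ) + n + 3 / 2))))
    Filter.atTop (nhds 0) := by
  rw [← mul_zero R]
  apply Filter.Tendsto.const_mul
  have h := tendsto_one_div_add_atTop_nhds_zero_nat (𝕜 := ℝ)
  refine squeeze_zero (fun k => by positivity) (fun k => ?_) h
  apply one_div_le_one_div_of_le (by positivity)
  have : (0 : ℝ) ≤ k := by positivity
  have : (0 : ℝ) ≤ n := by positivity
  nlinarith [mul_nonneg (α := ℝ) (Nat.cast_nonneg k) (Nat.cast_nonneg n)]

lemma sb_summable (n : ℕ) (t : ℝ) : Summable (fun k : ℕ => sbC n k * t ^ k) := by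
  rcases eq_or_ne t 0 with rfl | ht
  · apply summable_of_ne_finset_zero (s := {0})
    intro b hb
    have : b ≠ 0 := by simpa using hb
    simp [this]
  refine summable_of_ratio_test_tendsto_lt_one (l := 0) one_pos ?_ ?_
  · exact Filter.Eventually.of_forall fun k => mul_ne_zero (sbC_ne n k) (pow_ne_zero _ ht)
  · refine (sb_ratio n |t|).congr fun k => ?_
    have h0 := sbC_ne n k
    have h1 : (0:ℝ) < ((k : ℝ) + n + 3 / 2) := by positivity
    have h4 : (0:ℝ) < (k : ℝ) + 1 := by positivity
    rw [sbC_succ]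
    simp only [norm_mul, norm_neg, norm_div, norm_pow, Real.norm_eq_abs, abs_one, abs_of_pos h1,
      abs_of_pos h4, pow_succ]
    have : |sbC n k| ≠ 0 := by positivity
    have : |t| ≠ 0 := by positivity
    rw [abs_of_pos (by norm_num : (0:ℝ) < 4)]
    field_simp

lemma sbH_hasDeriv (n : ℕ) (t : ℝ) : HasDerivAt (sbH n) (-(1 / 4) * sbH (n + 1) t) t := by
  have key : ∀ y : ℝ, ∀ k : ℕ, sbC n (k + 1) * (((k + 1 : ℕ) : ℝ) * y ^ (k + 1 - 1))
      = -(1 / 4) * (sbC (n + 1) k * y ^ k) := by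
    intro y k
    have := sbC_diff n k
    rw [Nat.add_sub_cancel]
    push_cast
    linear_combination y ^ k * this
  have hs : ∀ y : ℝ, Summable (fun k : ℕ => sbC n k * ((k : ℝ) * y ^ (k - 1))) := by
    intro y
    rw [← summable_nat_add_iff 1]
    simp_rw [key]
    exact (sb_summable (n + 1) y).mul_left _
  have h := hasDerivAt_tsum_of_isPreconnected (𝕜 := ℝ) (g := fun k z => sbC n k * z ^ k)
    (g' := fun k y => sbC n k * ((k : ℝ) * y ^ (k - 1)))
    (u := fun k => |sbC n k * ((k : ℝ) * (|t| + 1) ^ (k - 1))|)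
    (t := Metric.ball 0 (|t| + 1)) (y₀ := t) (y := t)
    (hs _).abs Metric.isOpen_ball (convex_ball _ _).isPreconnected
    (fun k y _ => (hasDerivAt_pow k y).const_mul _)
    (fun k y hy => by
      have hy' : |y| ≤ |t| + 1 := by
        have := mem_ball_zero_iff.1 hy
        rw [Real.norm_eq_abs] at this
        exact this.le
      simp only [Real.norm_eq_abs, abs_mul, abs_pow]
      rw [abs_of_pos (by positivity : 0 < |t| + 1)]
      gcongr)
    (by simp) (sb_summable n t) (by simp)
  refine HasDerivAt.congr_deriv (h) (Eq.symm ?_)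
  rw [(hs t).tsum_eq_zero_add]
  simp_rw [key]
  rw [tsum_mul_left]
  simp [sbH]

lemma sbH_rec (n : ℕ) (t : ℝ) :
    t / 4 * sbH (n + 2) t - ((n : ℝ) + 3 / 2) * sbH (n + 1) t + sbH n t = 0 := by
  have h1 : sbH n t = ((n : ℝ) + 3 / 2) * sbH (n + 1) t +
      ∑' k : ℕ, (k : ℝ) * sbC (n + 1) k * t ^ k := by
    have hs : Summable (fun k : ℕ => (k : ℝ) * sbC (n + 1) k * t ^ k) := by
      have := (sb_summable n t).sub ((sb_summable (n + 1) t).mul_left ((n : ℝ) + 3 / 2))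
      refine this.congr fun k => ?_
      rw [sbC_n n k]; ring
    unfold sbH
    rw [← tsum_mul_left, ← ((sb_summable (n + 1) t).mul_left _).tsum_add hs]
    refine tsum_congr fun k => ?_
    rw [sbC_n n k]; ring
  have h2 : ∑' k : ℕ, (k : ℝ) * sbC (n + 1) k * t ^ k = -(t / 4) * sbH (n + 2) t := by
    have e : ∀ k : ℕ, ((k + 1 : ℕ) : ℝ) * sbC (n + 1) (k + 1) * t ^ (k + 1)
        = -(t / 4) * (sbC (n + 2) k * t ^ k) := by
      intro k
      have := sbC_diff (n + 1) k
      push_cast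
      rw [this]; ring
    rw [tsum_eq_zero_add']
    · simp_rw [e]
      rw [tsum_mul_left]; simp [sbH]
    · simp_rw [e]
      exact (sb_summable _ t).mul_left _
  rw [h1, h2]; ring

lemma sbH_analytic (n : ℕ) : AnalyticOnNhd ℝ (sbH n) Set.univ := by
  have hr : (FormalMultilinearSeries.ofScalars ℝ (sbC n)).radius = ⊤ := by
    apply FormalMultilinearSeries.ofScalars_radius_eq_top_of_tendsto
    · exact Filter.Eventually.of_forall (sbC_ne n)
    · refine (sb_ratio n 1).congr fun k => ?_
      have h0 := sbC_ne n k
      have h1 : (0:ℝ) < ((k : ℝ) + n + 3 / 2) := by positivity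
      have h4 : (0:ℝ) < (k : ℝ) + 1 := by positivity
      rw [Nat.succ_eq_add_one, sbC_succ]
      simp only [norm_mul, norm_neg, norm_div, Real.norm_eq_abs, abs_one, abs_of_pos h1,
        abs_of_pos h4]
      have : |sbC n k| ≠ 0 := by positivity
      rw [abs_of_pos (by norm_num : (0:ℝ) < 4)]
      field_simp
  have h := (FormalMultilinearSeries.ofScalars ℝ (sbC n)).hasFPowerSeriesOnBall
    (by rw [hr]; simp)
  have e : (FormalMultilinearSeries.ofScalars ℝ (sbC n)).sum = sbH n := by
    ext t
    simp [sbH, FormalMultilinearSeries.sum, FormalMultilinearSeries.ofScalars]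
  rw [e, hr] at h
  intro x _
  exact h.analyticAt_of_mem (by simp)

lemma sbH_nontrivial (n : ℕ) (a b : ℝ) (ha : 0 ≤ a) (hab : a < b)
    (h : ∀ x ∈ Set.Ioo a b, sbH n (x ^ 2) = 0) : False := by
  have hlt : a ^ 2 < b ^ 2 := by nlinarith
  have h0 : ∀ t ∈ Set.Ioo (a ^ 2) (b ^ 2), sbH n t = 0 := by
    intro t ht
    have ht0 : 0 ≤ t := (sq_nonneg a).trans ht.1.le
    rw [← Real.sq_sqrt ht0]
    apply h
    exact ⟨(Real.lt_sqrt ha).2 ht.1, (Real.sqrt_lt' (by linarith)).2 ht.2⟩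
  obtain ⟨m, hm⟩ := exists_between hlt
  have hz : sbH n = 0 := by
    refine (sbH_analytic n).eq_of_eventuallyEq (z₀ := m) (fun x _ => analyticAt_const) ?_
    filter_upwards [Ioo_mem_nhds hm.1 hm.2] with t ht
    exact h0 t ht
  have h1 : sbH n 0 = sbC n 0 := by
    unfold sbH
    rw [tsum_eq_single 0]
    · simp
    · intro k hk; simp [hk]
  exact sbC_ne n 0 (by rw [← h1, hz]; rfl)

noncomputable def sbS (n : ℕ) : ℝ := Real.sqrt π / 2 / 2 ^ n

lemma sbS_pos (n : ℕ) : 0 < sbS n := by unfold sbS; positivity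

noncomputable def sbF (n : ℕ) (x : ℝ) : ℝ := sbS n * x ^ n * sbH n (x ^ 2)

/-- The function x times the derivative of sbF. -/
noncomputable def sbP (n : ℕ) (x : ℝ) : ℝ :=
  sbS n * x ^ n * ((n : ℝ) * sbH n (x ^ 2) - x ^ 2 / 2 * sbH (n + 1) (x ^ 2))

lemma sbesselJ_eq (n : ℕ) (x : ℝ) (hx : 0 < x) : sbesselJ n x = sbF n x := by
  unfold sbesselJ besselJ sbF sbH
  rw [← tsum_mul_left, ← tsum_mul_left]
  refine tsum_congr fun k => ?_
  have e1 : (x / 2) ^ (2 * (k : ℝ) + ((n : ℝ) + 1 / 2)) =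
      (x / 2) ^ (2 * k + n) * Real.sqrt (x / 2) := by
    rw [← add_assoc, Real.rpow_add (by positivity), Real.sqrt_eq_rpow, ← Real.rpow_natCast]
    push_cast; rfl
  have e2 : Real.sqrt (π / (2 * x)) * Real.sqrt (x / 2) = Real.sqrt π / 2 := by
    rw [← Real.sqrt_mul (by positivity)]
    have : π / (2 * x) * (x / 2) = π / 2 ^ 2 := by field_simp
    rw [this, Real.sqrt_div (by positivity), Real.sqrt_sq (by norm_num)]
  have e3 : (k : ℝ) + ((n : ℝ) + 1 / 2) + 1 = (k : ℝ) + n + 3 / 2 := by ring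
  rw [e1, e3]
  have h0 := (sbGamma_pos n k).ne'
  have h3 : (k.factorial : ℝ) ≠ 0 := by positivity
  unfold sbC sbS
  have e4 : (x / 2) ^ (2 * k + n) = x ^ n * (x ^ 2) ^ k / (4 ^ k * 2 ^ n) := by
    rw [div_pow, pow_add, pow_add, pow_mul, pow_mul]; norm_num; ring
  rw [e4]
  calc _ = (Real.sqrt (π / (2 * x)) * Real.sqrt (x / 2)) * ((-1) ^ k /
        (k.factorial * Real.Gamma ((k : ℝ) + n + 3 / 2)) *
        (x ^ n * (x ^ 2) ^ k / (4 ^ k * 2 ^ n))) := by ring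
    _ = _ := by rw [e2]; field_simp

lemma sb_pow_hasDeriv (n : ℕ) (x : ℝ) (hx : x ≠ 0) :
    HasDerivAt (fun y : ℝ => y ^ n) ((n : ℝ) * x ^ n / x) x := by
  refine HasDerivAt.congr_deriv (hasDerivAt_pow n x) (Eq.symm ?_)
  cases n with
  | zero => simp
  | succ m => rw [Nat.add_sub_cancel, pow_succ]; field_simp

lemma sbHsq_hasDeriv (n : ℕ) (x : ℝ) :
    HasDerivAt (fun y : ℝ => sbH n (y ^ 2)) (-(x / 2) * sbH (n + 1) (x ^ 2)) x := by
  have := (sbH_hasDeriv n (x ^ 2)).comp x (hasDerivAt_pow 2 x)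
  refine HasDerivAt.congr_deriv (this) (Eq.symm ?_)
  norm_num; ring

lemma sbF_hasDeriv (n : ℕ) (x : ℝ) (hx : x ≠ 0) : HasDerivAt (sbF n) (sbP n x / x) x := by
  have := ((sb_pow_hasDeriv n x hx).const_mul (sbS n)).mul (sbHsq_hasDeriv n x)
  refine HasDerivAt.congr_deriv (this) (Eq.symm ?_)
  unfold sbP
  field_simp
  ring

lemma sbP_hasDeriv (n : ℕ) (x : ℝ) (hx : x ≠ 0) : HasDerivAt (sbP n)
    ((-sbP n x - (x ^ 2 - (n : ℝ) * ((n : ℝ) + 1)) * sbF n x) / x) x := by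
  have := ((sb_pow_hasDeriv n x hx).const_mul (sbS n)).mul
    (((sbHsq_hasDeriv n x).const_mul (n : ℝ)).sub
      (((hasDerivAt_pow 2 x).div_const 2).mul (sbHsq_hasDeriv (n + 1) x)))
  refine HasDerivAt.congr_deriv (this) (Eq.symm ?_)
  have hr := sbH_rec n (x ^ 2)
  unfold sbP sbF
  simp only [Pi.mul_apply, Pi.sub_apply]
  rw [show n + 1 + 1 = n + 2 from rfl]
  rw [div_eq_iff hx]
  have hc : (n : ℝ) * x ^ n / x * x = n * x ^ n := by field_simp
  push_cast
  generalize sbH n (x ^ 2) = A at *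
  generalize sbH (n + 1) (x ^ 2) = B at *
  generalize sbH (n + 2) (x ^ 2) = C at *
  generalize x ^ n = q at *
  field_simp
  linear_combination (-4 * sbS n * q * x ^ 2) * hr

lemma sbJ_deriv (n : ℕ) (x : ℝ) (hx : 0 < x) : deriv (sbesselJ n) x = sbP n x / x := by
  have : sbesselJ n =ᶠ[nhds x] sbF n := by
    filter_upwards [Ioi_mem_nhds hx] with y hy using sbesselJ_eq n y hy
  rw [this.deriv_eq, (sbF_hasDeriv n x hx.ne').deriv]

lemma sbF_nontrivial (n : ℕ) (a b : ℝ) (ha : 0 ≤ a) (hab : a < b)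
    (h : ∀ x ∈ Set.Ioo a b, sbF n x = 0) : False := by
  refine sbH_nontrivial n a b ha hab fun x hx => ?_
  have hx0 : 0 < x := ha.trans_lt hx.1
  have := h x hx
  unfold sbF at this
  have hs := sbS_pos n
  rcases mul_eq_zero.1 this with h | h
  · exact absurd h (by positivity)
  · exact h

noncomputable def sbL (n : ℕ) (x : ℝ) : ℝ :=
  sbF n x ^ 2 + sbP n x ^ 2 / (x ^ 2 - (n : ℝ) * ((n : ℝ) + 1))

lemma Lambda_eq (n : ℕ) (x : ℝ) (hx : 0 < x) : LambdaFun n x = sbL n x := by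
  unfold LambdaFun sbL
  rw [sbJ_deriv n x hx, sbesselJ_eq n x hx]
  field_simp

lemma sbL_hasDeriv (n : ℕ) (x : ℝ) (hx : 0 < x) (hk : 0 < x ^ 2 - (n : ℝ) * ((n : ℝ) + 1)) :
    HasDerivAt (sbL n) (-(sbP n x ^ 2 * (2 / (x * (x ^ 2 - (n : ℝ) * ((n : ℝ) + 1))) +
      2 * x / (x ^ 2 - (n : ℝ) * ((n : ℝ) + 1)) ^ 2))) x := by
  have := ((sbF_hasDeriv n x hx.ne').pow 2).add (((sbP_hasDeriv n x hx.ne').pow 2).div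
    ((hasDerivAt_pow 2 x).sub_const ((n : ℝ) * ((n : ℝ) + 1))) hk.ne')
  refine HasDerivAt.congr_deriv (this) (Eq.symm ?_)
  simp only [Pi.pow_apply]
  have hk' := hk.ne'
  generalize hK : (n : ℝ) * ((n : ℝ) + 1) = K at *
  field_simp
  norm_num
  field_simp
  ring

lemma sb_sq_pos (n : ℕ) (x : ℝ) (h : Real.sqrt ((n : ℝ) * ((n : ℝ) + 1)) < x) :
    0 < x ∧ 0 < x ^ 2 - (n : ℝ) * ((n : ℝ) + 1) := by
  have hx : 0 < x := (Real.sqrt_nonneg _).trans_lt h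
  exact ⟨hx, sub_pos.2 ((Real.sqrt_lt' hx).1 h)⟩

lemma sbL_strict (n : ℕ) (x y : ℝ) (h : Real.sqrt ((n : ℝ) * ((n : ℝ) + 1)) < x) (hxy : x < y) :
    sbL n y < sbL n x := by
  have hp : ∀ z ∈ Set.Icc x y, 0 < z ∧ 0 < z ^ 2 - (n : ℝ) * ((n : ℝ) + 1) := fun z hz =>
    sb_sq_pos n z (h.trans_le hz.1)
  have hd := fun z hz => sbL_hasDeriv n z (hp z hz).1 (hp z hz).2
  have hanti : AntitoneOn (sbL n) (Set.Icc x y) := by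
    refine antitoneOn_of_deriv_nonpos (convex_Icc x y)
      (fun z hz => (hd z hz).continuousAt.continuousWithinAt)
      (fun z hz => (hd z (interior_subset hz)).differentiableAt.differentiableWithinAt) ?_
    intro z hz
    have := hp z (interior_subset hz)
    rw [(hd z (interior_subset hz)).deriv, neg_nonpos]
    have h1 := this.1
    have h2 := this.2
    positivity
  have hx : x ∈ Set.Icc x y := ⟨le_rfl, hxy.le⟩
  have hy : y ∈ Set.Icc x y := ⟨hxy.le, le_rfl⟩
  refine lt_of_le_of_ne (hanti hx hy hxy.le) fun heq => ?_
  have hconst : ∀ z ∈ Set.Icc x y, sbL n z = sbL n x := fun z hz =>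
    le_antisymm (hanti hx hz hz.1) (heq ▸ hanti hz hy hz.2)
  have hP : ∀ z ∈ Set.Ioo x y, sbP n z = 0 := by
    intro z hz
    have hz' := Set.Ioo_subset_Icc_self hz
    have h1 := (hp z hz').1
    have h2 := (hp z hz').2
    have he : sbL n =ᶠ[nhds z] fun _ => sbL n x := by
      filter_upwards [Icc_mem_nhds hz.1 hz.2] with w hw using hconst w hw
    have h3 := he.deriv_eq
    rw [(hd z hz').deriv, deriv_const, neg_eq_zero] at h3
    rcases mul_eq_zero.1 h3 with h3 | h3
    · exact pow_eq_zero_iff (two_ne_zero) |>.1 h3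
    · exact absurd h3 (by positivity)
  refine sbF_nontrivial n x y (hp x hx).1.le hxy fun z hz => ?_
  have hz' := Set.Ioo_subset_Icc_self hz
  have h1 := (hp z hz').1
  have h2 := (hp z hz').2
  have he : sbP n =ᶠ[nhds z] fun _ => 0 := by
    filter_upwards [Ioo_mem_nhds hz.1 hz.2] with w hw using hP w hw
  have h3 := he.deriv_eq
  rw [(sbP_hasDeriv n z h1.ne').deriv, deriv_const, hP z hz, div_eq_zero_iff] at h3
  rcases h3 with h3 | h3
  · have : (z ^ 2 - (n : ℝ) * ((n : ℝ) + 1)) * sbF n z = 0 := by linarith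
    exact (mul_eq_zero.1 this).resolve_left h2.ne'
  · exact absurd h3 h1.ne'

lemma sb_crit (n : ℕ) (g : ℝ) (hg : 0 < g) (h : deriv (sbesselJ n) g = 0) :
    Real.sqrt ((n : ℝ) * ((n : ℝ) + 1)) < g := by
  by_contra hle
  rw [not_lt, Real.le_sqrt hg.le (by positivity)] at hle
  have hPg : sbP n g = 0 := by
    rw [sbJ_deriv n g hg] at h
    exact (div_eq_zero_iff.1 h).resolve_right hg.ne'
  have hHc : ∀ m, Continuous (sbH m) := fun m =>
    continuous_iff_continuousAt.2 fun t => (sbH_hasDeriv m t).continuousAt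
  have hc : Continuous (fun x => x * (sbF n x * sbP n x)) := by
    have h1 := hHc n
    have h2 := hHc (n + 1)
    unfold sbF sbP
    fun_prop
  have hd : ∀ z : ℝ, z ≠ 0 → HasDerivAt (fun x => x * (sbF n x * sbP n x))
      (sbP n z ^ 2 + ((n : ℝ) * ((n : ℝ) + 1) - z ^ 2) * sbF n z ^ 2) z := by
    intro z hz
    have := (hasDerivAt_id z).mul ((sbF_hasDeriv n z hz).mul (sbP_hasDeriv n z hz))
    refine HasDerivAt.congr_deriv (this) (Eq.symm ?_)
    simp only [Pi.mul_apply, id]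
    field_simp
    ring
  have hpos : ∀ z ∈ Set.Ioo 0 g, 0 < (n : ℝ) * ((n : ℝ) + 1) - z ^ 2 := by
    intro z hz
    nlinarith [hz.1, hz.2]
  have hmono : MonotoneOn (fun x => x * (sbF n x * sbP n x)) (Set.Icc 0 g) := by
    refine monotoneOn_of_deriv_nonneg (convex_Icc _ _) hc.continuousOn ?_ ?_
    · rw [interior_Icc]
      exact fun z hz => (hd z hz.1.ne').differentiableAt.differentiableWithinAt
    · rw [interior_Icc]
      intro z hz
      rw [(hd z hz.1.ne').deriv]
      have := hpos z hz
      positivity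
  refine sbF_nontrivial n 0 g le_rfl hg fun z hz => ?_
  have he : (fun x => x * (sbF n x * sbP n x)) =ᶠ[nhds z] fun _ => 0 := by
    filter_upwards [Icc_mem_nhds hz.1 hz.2] with w hw
    have h1 := hmono ⟨le_rfl, hg.le⟩ hw hw.1
    have h2 := hmono hw ⟨hg.le, le_rfl⟩ hw.2
    simp only [hPg, mul_zero, zero_mul] at h1 h2
    exact le_antisymm h2 h1
  have h3 := he.deriv_eq
  rw [(hd z hz.1.ne').deriv, deriv_const] at h3
  have h4 := hpos z hz
  have h5 : ((n : ℝ) * ((n : ℝ) + 1) - z ^ 2) * sbF n z ^ 2 = 0 := by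
    have : 0 ≤ ((n : ℝ) * ((n : ℝ) + 1) - z ^ 2) * sbF n z ^ 2 := by positivity
    nlinarith [sq_nonneg (sbP n z)]
  exact pow_eq_zero_iff two_ne_zero |>.1 ((mul_eq_zero.1 h5).resolve_left h4.ne')

theorem sbessel_extrema_decrease (n : ℕ)
    (γ' : ℕ → ℝ)
    (hγ'_pos : ∀ k : ℕ, 1 ≤ k → 0 < γ' k)
    (hγ'_zero : ∀ k : ℕ, 1 ≤ k → deriv (sbesselJ n) (γ' k) = 0)
    (hγ'_mono : ∀ k l : ℕ, 1 ≤ k → k < l → γ' k < γ' l)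
    (hγ'_surj : ∀ x : ℝ, 0 < x → deriv (sbesselJ n) x = 0 → ∃ k, 1 ≤ k ∧ γ' k = x) :
    (∀ x y : ℝ, Real.sqrt ((n : ℝ) * ((n : ℝ) + 1)) < x → x < y →
        LambdaFun n y < LambdaFun n x) ∧
      (∀ k : ℕ, 1 ≤ k → Real.sqrt ((n : ℝ) * ((n : ℝ) + 1)) < γ' k) ∧
      (∀ k : ℕ, 1 ≤ k → LambdaFun n (γ' k) = sbesselJ n (γ' k) ^ 2) ∧
      (∀ k : ℕ, 1 ≤ k → |sbesselJ n (γ' (k + 1))| < |sbesselJ n (γ' k)|) := by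
  have hmain : ∀ x y : ℝ, Real.sqrt ((n : ℝ) * ((n : ℝ) + 1)) < x → x < y →
      LambdaFun n y < LambdaFun n x := by
    intro x y hx hxy
    have h0 := (sb_sq_pos n x hx).1
    rw [Lambda_eq n x h0, Lambda_eq n y (h0.trans hxy)]
    exact sbL_strict n x y hx hxy
  have hcrit : ∀ k : ℕ, 1 ≤ k → Real.sqrt ((n : ℝ) * ((n : ℝ) + 1)) < γ' k :=
    fun k hk => sb_crit n _ (hγ'_pos k hk) (hγ'_zero k hk)
  have hval : ∀ k : ℕ, 1 ≤ k → LambdaFun n (γ' k) = sbesselJ n (γ' k) ^ 2 := by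
    intro k hk
    unfold LambdaFun
    rw [hγ'_zero k hk]
    ring
  refine ⟨hmain, hcrit, hval, fun k hk => ?_⟩
  have := hmain _ _ (hcrit k hk) (hγ'_mono k (k + 1) hk (Nat.lt_succ_self k))
  rw [hval k hk, hval (k + 1) (by omega)] at this
  exact sq_lt_sq.1 this
end

section
/- For every real u ∈ (0,1), one has ((1 − u)/(1 + u)) · e^{2u} < 1 − (2/3) u³. -/
theorem frac_exp_lt (u : ℝ) (hu : u ∈ Set.Ioo (0 : ℝ) 1) :
    (1 - u) / (1 + u) * Real.exp (2 * u) < 1 - 2 / 3 * u ^ 3 := by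
  obtain ⟨h0, h1⟩ := hu
  have hd : ∀ x : ℝ, 0 ≤ x → HasDerivAt
      (fun x : ℝ => (1 - x) / (1 + x) * Real.exp (2 * x) + 2 / 3 * x ^ 3)
      (2 * x ^ 2 - 2 * x ^ 2 * Real.exp (2 * x) / (1 + x) ^ 2) x := by
    intro x hx
    have hne : 1 + x ≠ 0 := by positivity
    have e1 : HasDerivAt (fun x : ℝ => 1 - x) (-1) x := (hasDerivAt_id x).const_sub 1
    have e2 : HasDerivAt (fun x : ℝ => 1 + x) 1 x := (hasDerivAt_id x).const_add 1
    have e3 : HasDerivAt (fun x : ℝ => 2 * x) (2 * 1) x := (hasDerivAt_id x).const_mul 2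
    have e4 := (hasDerivAt_pow 3 x).const_mul (2 / 3 : ℝ)
    refine (((e1.div e2 hne).mul e3.exp).add e4).congr_deriv ?_
    simp only [Pi.div_apply]
    field_simp
    push_cast
    ring
  have hanti : StrictAntiOn
      (fun x : ℝ => (1 - x) / (1 + x) * Real.exp (2 * x) + 2 / 3 * x ^ 3) (Set.Ici 0) := by
    apply strictAntiOn_of_deriv_neg (convex_Ici 0)
    · intro x hx
      exact (hd x hx).continuousAt.continuousWithinAt
    · intro x hx
      rw [interior_Ici] at hx
      have hx : 0 < x := hx
      rw [(hd x hx.le).deriv, sub_neg, lt_div_iff₀ (by positivity)]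
      have h := Real.add_one_lt_exp hx.ne'
      have he : Real.exp (2 * x) = Real.exp x ^ 2 := by
        rw [← Real.exp_nat_mul]; norm_num
      rw [he]
      have : (1 + x) ^ 2 < Real.exp x ^ 2 := by
        apply pow_lt_pow_left₀ (by linarith) (by linarith) (by norm_num)
      exact mul_lt_mul_of_pos_left this (by positivity)
  have := hanti (Set.mem_Ici.2 le_rfl) (Set.mem_Ici.2 h0.le) h0
  norm_num at this
  linarith
end
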